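/- For every cylinder order ⪯ on {0,1}^∞ with 0^∞ ≺ 1^∞ and every σ ∈ {ρ_0, ρ_1, ρ_2, τ_{0,1}}, there exists a consistent cylinder order ≤ on {0,±1}^∞ with 0^∞ < 1^∞ such that m^abs_≤ = σ(m_⪯). -/

import Mathlib

open scoped Classical

noncomputable section

/-- The ultrametric on infinite words: `d(a,b) = 2^{-min{n ≥ 1 : a_n ≠ b_n}}`
(words are indexed from 0 here, so position `i` corresponds to `n = i+1`). -/
noncomputable def wdist {A : Type*} [DecidableEq A] (a b : ℕ → A) : ℝ :=
  if h : ∃ n, a n ≠ b n then (2 : ℝ)⁻¹ ^ (Nat.find h + 1) else 0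

/-- The tail `a_{k+1} a_{k+2} ⋯` of an infinite word. -/
def shiftn {A : Type*} (a : ℕ → A) (k : ℕ) : ℕ → A := fun n => a (n + k)

/-- The set of tails of an infinite word (including the word itself). -/
def tails {A : Type*} (a : ℕ → A) : Set (ℕ → A) := {b | ∃ k, b = shiftn a k}

/-- A cylinder order: a total order such that `a ≤ b ≤ c` implies `d(a,b) ≤ d(a,c)`. -/
def IsCylOrder {A : Type*} [DecidableEq A] (le : (ℕ → A) → (ℕ → A) → Prop) : Prop :=
  (∀ a b, le a b ∨ le b a) ∧
  (∀ a b, le a b → le b a → a = b) ∧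
  (∀ a b c, le a b → le b c → le a c) ∧
  (∀ a b c, le a b → le b c → wdist a b ≤ wdist a c)

/-- Strict comparison associated to an order relation. -/
def wlt {A : Type*} (le : (ℕ → A) → (ℕ → A) → Prop) (a b : ℕ → A) : Prop :=
  le a b ∧ a ≠ b

/-- `m` is the least upper bound of the set `s` with respect to `le`. -/
def IsSupOf {A : Type*} (le : (ℕ → A) → (ℕ → A) → Prop) (s : Set (ℕ → A))
    (m : ℕ → A) : Prop :=
  (∀ x ∈ s, le x m) ∧ ∀ b, (∀ x ∈ s, le x b) → le m b

/-- The set `M_≤ = {s_≤(a) : a ∈ A^∞}` of sup-words. -/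
def supWords {A : Type*} (le : (ℕ → A) → (ℕ → A) → Prop) : Set (ℕ → A) :=
  {m | ∃ a, IsSupOf le (tails a) m}

/-- `x` is an accumulation point of `M` in the metric `wdist`. -/
def IsAccPt' {A : Type*} [DecidableEq A] (M : Set (ℕ → A)) (x : ℕ → A) : Prop :=
  ∀ ε : ℝ, 0 < ε → ∃ y ∈ M, y ≠ x ∧ wdist x y < ε

/-- `x` is the smallest (w.r.t. `le`) accumulation point of `M`. -/
def IsSmallestAcc {A : Type*} [DecidableEq A] (le : (ℕ → A) → (ℕ → A) → Prop)
    (M : Set (ℕ → A)) (x : ℕ → A) : Prop :=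
  IsAccPt' M x ∧ ∀ y, IsAccPt' M y → le x y

/-- Membership in the cylinder given by the finite word `w`. -/
def inCyl {A : Type*} (w : List A) (a : ℕ → A) : Prop :=
  ∀ i : Fin w.length, a i.val = w.get i

/-- `[u] < [v]` for cylinders: every element of `[u]` is strictly below every element of `[v]`. -/
def cylLt {A : Type*} (le : (ℕ → A) → (ℕ → A) → Prop) (u v : List A) : Prop :=
  ∀ a b, inCyl u a → inCyl v b → wlt le a b

/-- Infinite binary words. -/
abbrev W2 := ℕ → Bool

/-- The word `0^∞`. -/
def w0 : W2 := fun _ => false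

/-- The word `1^∞`. -/
def w1 : W2 := fun _ => true

/-- The word `10^∞`. -/
def w10inf : W2 := fun n => decide (n = 0)

/-- The periodic word `w^∞` for a finite word `w`. -/
def perW (w : List Bool) : W2 := fun n => w.getD (n % w.length) false

/-- A substitution on `{0,1}`, given by the images of the two letters. -/
abbrev Sub2 := Bool → List Bool

/-- Action of a substitution on finite words. -/
def listApply (f : Sub2) (l : List Bool) : List Bool := (l.map f).flatten

/-- Action of a (nonerasing) substitution on infinite words. -/
def subApply (f : Sub2) (a : W2) : W2 :=
  fun n => (listApply f (List.ofFn (fun i : Fin (n + 1) => a i.val))).getD n false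

/-- The substitution `τ_{j,k} : 0 ↦ 10^j, 1 ↦ 10^k`. -/
def tauS (j k : ℕ) : Sub2 := fun b => true :: List.replicate (if b then k else j) false

/-- Membership in the set `S = {τ_{j,k} : 0 ≤ j < k}`. -/
def memS (f : Sub2) : Prop := ∃ j k : ℕ, j < k ∧ f = tauS j k

/-- Apply a finite composition `σ_1 ∘ ⋯ ∘ σ_n` (given as a list) to an infinite word. -/
def applyList (L : List Sub2) (a : W2) : W2 := L.foldr subApply a

/-- Apply a finite composition `σ_1 ∘ ⋯ ∘ σ_n` (given as a list) to a finite word. -/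
def listApplyL (L : List Sub2) (l : List Bool) : List Bool := L.foldr listApply l

/-- `σ_{[1,n]} = σ_1 ∘ ⋯ ∘ σ_n` applied to an infinite word, for `σ ∈ S^∞`
(indexed from 0 in Lean). -/
def compUpTo (σ : ℕ → Sub2) (n : ℕ) (a : W2) : W2 :=
  applyList (List.ofFn (fun i : Fin n => σ i.val)) a

/-- `m` is the limit word `lim_{n → ∞} σ_{[1,n]}(a)`. -/
def IsLimitWord (σ : ℕ → Sub2) (a m : W2) : Prop :=
  ∀ ε : ℝ, 0 < ε → ∃ N : ℕ, ∀ n ≥ N, wdist (compUpTo σ n a) m < ε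

/-- The symmetric alphabet `{0, ±1}`. -/
inductive T3 where
  | neg : T3
  | zer : T3
  | pos : T3
deriving DecidableEq

/-- The integer value of a letter in `{0, ±1}`. -/
def T3.toInt : T3 → ℤ
  | .neg => -1
  | .zer => 0
  | .pos => 1

/-- Negation of a letter. -/
def T3.negT : T3 → T3
  | .neg => .pos
  | .zer => .zer
  | .pos => .neg

/-- The natural order `-1 < 0 < 1` on letters. -/
def t3lt (x y : T3) : Prop := x.toInt < y.toInt

/-- Infinite words over `{0, ±1}`. -/
abbrev W3 := ℕ → T3

/-- Letterwise negation of a word. -/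
def negW (a : W3) : W3 := fun n => (a n).negT

/-- Strict lexicographic order on `{0,±1}^∞` induced by `-1 < 0 < 1`. -/
def lex3lt (a b : W3) : Prop := ∃ i : ℕ, (∀ m < i, a m = b m) ∧ t3lt (a i) (b i)

/-- Lexicographic order on `{0,±1}^∞` induced by `-1 < 0 < 1`. -/
def lex3le (a b : W3) : Prop := a = b ∨ lex3lt a b

/-- The word `0^∞` over `{0,±1}`. -/
def zeroW3 : W3 := fun _ => T3.zer

/-- The word `1^∞` over `{0,±1}`. -/
def oneW3 : W3 := fun _ => T3.pos

/-- `abs(a) = a` if `a ≥_lex 0^∞` and `-a` otherwise. -/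
noncomputable def absW (a : W3) : W3 := if lex3le zeroW3 a then a else negW a

/-- The set `{abs(a_n a_{n+1} ⋯) : n ≥ 1}`. -/
def absTails (a : W3) : Set W3 := {b | ∃ k, b = absW (shiftn a k)}

/-- The set `M^abs_≤ = {s^abs_≤(a) : a ∈ {0,±1}^∞}`, where `s^abs_≤(a)` is the least upper
bound of `{abs(a_n a_{n+1} ⋯) : n ≥ 1}` with respect to `≤`. -/
def MAbs (le : W3 → W3 → Prop) : Set W3 := {m | ∃ a, IsSupOf le (absTails a) m}

/-- A cylinder order on `{0,±1}^∞` is consistent if for each finite word `w` either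
`[w(-1)] < [w0] < [w1]` or `[w(-1)] > [w0] > [w1]`. -/
def Consistent (le : W3 → W3 → Prop) : Prop :=
  ∀ w : List T3,
    (cylLt le (w ++ [T3.neg]) (w ++ [T3.zer]) ∧ cylLt le (w ++ [T3.zer]) (w ++ [T3.pos])) ∨
    (cylLt le (w ++ [T3.pos]) (w ++ [T3.zer]) ∧ cylLt le (w ++ [T3.zer]) (w ++ [T3.neg]))

/-- Image of a letter under a `ρ`-map: letter `0 ↦ e` and letter `1 ↦ e0`, where the
sign `e` is `1` if the parity bit is `true` and `-1` otherwise. -/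
def rhoImg (e : Bool) (b : Bool) : List T3 :=
  (if e then T3.pos else T3.neg) :: (if b then [T3.zer] else [])

/-- The `ρ`-map on finite words determined by a parity function `par` (where `par w`
is `true` when the relevant count of `w` is even). -/
def rhoL (par : List Bool → Bool) (l : List Bool) : List T3 :=
  (List.ofFn (fun i : Fin l.length => rhoImg (par (l.take i.val)) (l.get i))).flatten

/-- The extension of a `ρ`-map to infinite words (as the limit of its values on prefixes). -/
def rhoW (par : List Bool → Bool) (a : W2) : W3 :=
  fun n => (rhoL par (List.ofFn (fun i : Fin (n + 1) => a i.val))).getD n T3.zer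

/-- Parity for `ρ_0`: evenness of the number of 0's. -/
def par0 : List Bool → Bool := fun w => decide (Even (w.count false))

/-- Parity for `ρ_1`: evenness of the number of 1's. -/
def par1 : List Bool → Bool := fun w => decide (Even (w.count true))

/-- Parity for `ρ_2`: evenness of the length. -/
def par2 : List Bool → Bool := fun w => decide (Even w.length)

/-- The substitution `τ_{0,1} : 0 ↦ 1, 1 ↦ 10` viewed with values in `{0,±1}`. -/
def tau01T : Bool → List T3 := fun b => if b then [T3.pos, T3.zer] else [T3.pos]

/-- Action on infinite words of a substitution from `{0,1}` to `{0,±1}`-words. -/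
def subApply3 (f : Bool → List T3) (a : W2) : W3 :=
  fun n => ((List.ofFn (fun i : Fin (n + 1) => a i.val)).map f).flatten.getD n T3.zer

/-- The set of maps `{ρ_0, ρ_1, ρ_2, τ_{0,1}}` from `{0,1}^∞` to `{0,±1}^∞`. -/
def sigmaSet : Set (W2 → W3) := {rhoW par0, rhoW par1, rhoW par2, subApply3 tau01T}

/-- The words `a` and `b` have the same first `n` letters. -/
def AgreeTo {A : Type*} (n : ℕ) (a b : ℕ → A) : Prop := ∀ m < n, a m = b m

namespace AgreeTo

variable {A : Type*} {n k : ℕ} {a b c : ℕ → A}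

lemma symm (h : AgreeTo n a b) : AgreeTo n b a := fun m hm => (h m hm).symm

lemma trans (h : AgreeTo n a b) (h' : AgreeTo n b c) : AgreeTo n a c :=
  fun m hm => (h m hm).trans (h' m hm)

lemma mono (h : AgreeTo n a b) (hk : k ≤ n) : AgreeTo k a b :=
  fun m hm => h m (hm.trans_le hk)

lemma succ (h : AgreeTo n a b) (h' : a n = b n) : AgreeTo (n + 1) a b := fun m hm => by
  rcases Nat.lt_succ_iff_lt_or_eq.mp hm with hm | rfl
  exacts [h m hm, h']

end AgreeTo

section Cylinder

variable {A : Type*}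

lemma exists_first_diff {a b : ℕ → A} (h : a ≠ b) : ∃ n, AgreeTo n a b ∧ a n ≠ b n := by
  have hex : ∃ n, a n ≠ b n := Function.ne_iff.mp h
  exact ⟨Nat.find hex, fun m hm => not_not.mp (Nat.find_min hex hm), Nat.find_spec hex⟩

lemma eq_of_forall_agreeTo {a b : ℕ → A} (h : ∀ n, AgreeTo n a b) : a = b :=
  funext fun n => h (n + 1) n n.lt_succ_self

variable [DecidableEq A]

lemma wdist_lt_iff (a b : ℕ → A) (n : ℕ) : wdist a b < (2 : ℝ)⁻¹ ^ n ↔ AgreeTo n a b := by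
  unfold wdist
  split_ifs with h
  · rw [pow_lt_pow_iff_right_of_lt_one₀ (by norm_num) (by norm_num), Nat.lt_succ_iff,
      Nat.le_find_iff]
    simp [AgreeTo]
  · push Not at h
    exact ⟨fun _ m _ => h m, fun _ => by positivity⟩

lemma wdist_nonneg (a b : ℕ → A) : 0 ≤ wdist a b := by
  unfold wdist
  split_ifs <;> positivity

lemma wdist_le_of_agreeTo {a b c : ℕ → A} (h : ∀ n, AgreeTo n a c → AgreeTo n a b) :
    wdist a b ≤ wdist a c := by
  by_cases hab : a = b
  · subst hab
    have : wdist a a = 0 := by simp [wdist]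
    exact this ▸ wdist_nonneg a c
  · obtain ⟨n, -, hn⟩ := exists_first_diff hab
    have hac : ∃ m, a m ≠ c m := by
      by_contra! hac
      exact hn (h (n + 1) (fun m _ => hac m) n n.lt_succ_self)
    have hval : wdist a c = (2 : ℝ)⁻¹ ^ (Nat.find hac + 1) := by simp only [wdist, dif_pos hac]
    have hag : AgreeTo (Nat.find hac) a b :=
      h _ fun m hm => not_not.mp (Nat.find_min hac hm)
    have hex : ∃ m, a m ≠ b m := ⟨n, hn⟩
    rw [hval]
    simp only [wdist, dif_pos hex]
    refine pow_le_pow_of_le_one (by norm_num) (by norm_num) (Nat.succ_le_succ ?_)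
    rw [Nat.le_find_iff]
    exact fun m hm => not_not.mpr (hag m hm)

lemma isAccPt'_iff (M : Set (ℕ → A)) (x : ℕ → A) :
    IsAccPt' M x ↔ ∀ n, ∃ y ∈ M, y ≠ x ∧ AgreeTo n x y := by
  constructor
  · intro h n
    obtain ⟨y, hy, hne, hd⟩ := h ((2 : ℝ)⁻¹ ^ n) (by positivity)
    exact ⟨y, hy, hne, (wdist_lt_iff x y n).mp hd⟩
  · intro h ε hε
    obtain ⟨n, hn⟩ := exists_pow_lt_of_lt_one hε (by norm_num : (2 : ℝ)⁻¹ < 1)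
    obtain ⟨y, hy, hne, hd⟩ := h n
    exact ⟨y, hy, hne, ((wdist_lt_iff x y n).mpr hd).trans hn⟩

namespace IsCylOrder

variable {le : (ℕ → A) → (ℕ → A) → Prop}

lemma refl (h : IsCylOrder le) (a : ℕ → A) : le a a := (h.1 a a).elim id id

lemma agreeTo (h : IsCylOrder le) {a b c : ℕ → A} (hab : le a b) (hbc : le b c) {n : ℕ}
    (hac : AgreeTo n a c) : AgreeTo n a b :=
  (wdist_lt_iff a b n).mp ((h.2.2.2 a b c hab hbc).trans_lt ((wdist_lt_iff a c n).mpr hac))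

lemma le_congr (h : IsCylOrder le) {p q p' q' : ℕ → A} {k : ℕ} (hpq : le p q)
    (hk : p k ≠ q k) (hp : AgreeTo (k + 1) p p') (hq : AgreeTo (k + 1) q q') : le p' q' := by
  have hk1 := k.lt_succ_self
  have h1 : le p' q := (h.1 p' q).resolve_right fun hc =>
    hk (h.agreeTo hpq hc hp k hk1)
  refine (h.1 p' q').resolve_right fun hc => hk ?_
  rw [hp k hk1, hq k hk1, h.agreeTo hc h1 hq.symm k hk1]

/-- A nonempty set of words over a finite alphabet has an upper bound in its closure. -/
lemma exists_closure_upper [Finite A] (h : IsCylOrder le) {S : Set (ℕ → A)}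
    (hS : S.Nonempty) :
    ∃ y, (∀ x ∈ S, le x y) ∧ ∀ n, ∃ x ∈ S, AgreeTo n y x := by
  let _ : TopologicalSpace A := ⊥
  have : DiscreteTopology A := ⟨rfl⟩
  have hopen : ∀ (n : ℕ) (y : ℕ → A), IsOpen {x | AgreeTo n y x} := by
    intro n y
    have : {x | AgreeTo n y x} = ⋂ m ∈ Set.Iio n, {x : ℕ → A | x m = y m} := by
      ext x
      simp [AgreeTo, eq_comm]
    rw [this]
    refine (Set.finite_Iio n).isOpen_biInter fun m _ => ?_
    exact (isOpen_discrete ({y m} : Set A)).preimage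
      (continuous_apply (A := fun _ : ℕ => A) m)
  have hclosed : ∀ x, IsClosed {y | le x y} := by
    intro x
    rw [← isOpen_compl_iff, isOpen_iff_forall_mem_open]
    intro y hy
    have hne : y ≠ x := fun hyx => hy (hyx ▸ h.refl x)
    obtain ⟨n, -, hn⟩ := exists_first_diff hne
    refine ⟨_, fun z hz hxz => ?_, hopen (n + 1) y, fun _ _ => rfl⟩
    have hle : le z x := h.le_congr ((h.1 x y).resolve_left hy) hn hz fun _ _ => rfl
    have := h.2.1 _ _ hle hxz
    exact hn (this ▸ hz n n.lt_succ_self)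
  let K : S → Set (ℕ → A) := fun x => closure S ∩ {y | le x y}
  obtain ⟨y, hy⟩ : (⋂ x, K x).Nonempty := by
    have : Nonempty S := hS.to_subtype
    refine IsCompact.nonempty_iInter_of_directed_nonempty_isCompact_isClosed K ?_ ?_ ?_ ?_
    · intro x y
      rcases h.1 x y with hxy | hxy
      · exact ⟨y, fun z hz => ⟨hz.1, h.2.2.1 _ _ _ hxy hz.2⟩, fun z hz => hz⟩
      · exact ⟨x, fun z hz => hz, fun z hz => ⟨hz.1, h.2.2.1 _ _ _ hxy hz.2⟩⟩
    · exact fun x => ⟨x, subset_closure x.2, h.refl x⟩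
    · exact fun x => (isClosed_closure.inter (hclosed x)).isCompact
    · exact fun x => isClosed_closure.inter (hclosed x)
  rw [Set.mem_iInter] at hy
  refine ⟨y, fun x hx => (hy ⟨x, hx⟩).2, fun n => ?_⟩
  obtain ⟨x0, hx0⟩ := hS
  obtain ⟨x, hxn, hxS⟩ := mem_closure_iff.mp (hy ⟨x0, hx0⟩).1 _ (hopen n y) fun _ _ => rfl
  exact ⟨x, hxS, hxn⟩

lemma isSupOf_of_agreeTo (h : IsCylOrder le) {S : Set (ℕ → A)} {m : ℕ → A}
    (hub : ∀ x ∈ S, le x m) (hcl : ∀ n, ∃ x ∈ S, AgreeTo n m x) : IsSupOf le S m := by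
  refine ⟨hub, fun b hb => ?_⟩
  by_contra hmb
  have hne : m ≠ b := fun hmb' => hmb (hmb' ▸ h.refl m)
  obtain ⟨n, -, hn⟩ := exists_first_diff hne
  obtain ⟨x, hx, hxn⟩ := hcl (n + 1)
  have h1 : le b x :=
    h.le_congr ((h.1 m b).resolve_left hmb) hn.symm (fun _ _ => rfl) hxn
  have h2 := h.2.1 _ _ h1 (hb x hx)
  exact hn (h2 ▸ hxn n n.lt_succ_self)

lemma exists_agreeTo_of_isSupOf [Finite A] (h : IsCylOrder le) {S : Set (ℕ → A)} {m : ℕ → A}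
    (hS : S.Nonempty) (hm : IsSupOf le S m) (n : ℕ) : ∃ x ∈ S, AgreeTo n m x := by
  obtain ⟨y, hy, hcl⟩ := h.exists_closure_upper hS
  rw [h.2.1 _ _ (hm.2 y hy) ((h.isSupOf_of_agreeTo hy hcl).2 m hm.1)]
  exact hcl n

end IsCylOrder

end Cylinder

section Encoding

/-- The letter `x` or its negative, according to the bit `s`. -/
def sgT (s : Bool) (x : T3) : T3 := if s then x.negT else x

@[simp] lemma sgT_false (x : T3) : sgT false x = x := rfl

@[simp] lemma sgT_true (x : T3) : sgT true x = x.negT := rfl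

@[simp] lemma negT_negT (x : T3) : x.negT.negT = x := by cases x <;> rfl

@[simp] lemma sgT_sgT (s : Bool) (x : T3) : sgT s (sgT s x) = x := by cases s <;> simp

@[simp] lemma sgT_zer (s : Bool) : sgT s T3.zer = T3.zer := by cases s <;> rfl

lemma sgT_injective (s : Bool) : Function.Injective (sgT s) :=
  Function.LeftInverse.injective (sgT_sgT s)

lemma sgT_pos_ne_zer (s : Bool) : sgT s T3.pos ≠ T3.zer := by cases s <;> decide

lemma sgT_pos_injective {s t : Bool} (h : sgT s T3.pos = sgT t T3.pos) : s = t := by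
  cases s <;> cases t <;> first | rfl | cases h

/-- The letterwise signed copy of an infinite word. -/
def sgW (s : Bool) (a : W3) : W3 := fun n => sgT s (a n)

/-- The image of a finite word where `0 ↦ e`, `1 ↦ e0`, and the sign `e` is flipped after each
letter `c` with `f c = true`. -/
def signedImage (f : Bool → Bool) : List Bool → List T3
  | [] => []
  | c :: l => T3.pos :: ((if c then [T3.zer] else []) ++ (signedImage f l).map (sgT (f c)))

/-- The extension of `signedImage` to infinite words. -/
def encode (f : Bool → Bool) (a : W2) : W3 :=
  fun n => (signedImage f (List.ofFn fun i : Fin (n + 1) => a i.val)).getD n T3.zer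

lemma rhoL_cons (par : List Bool → Bool) (c : Bool) (l : List Bool) :
    rhoL par (c :: l) = rhoImg (par []) c ++ rhoL (fun w => par (c :: w)) l := by
  simp [rhoL, List.ofFn_succ]

lemma rhoL_not (par : List Bool → Bool) (l : List Bool) :
    rhoL (fun w => !par w) l = (rhoL par l).map T3.negT := by
  simp only [rhoL, List.map_flatten, List.map_ofFn]
  congr 2
  funext i
  cases h : par (l.take i) <;> cases h' : l.get i <;>
    simp [rhoImg, h, h', T3.negT, -List.get_eq_getElem]

lemma rhoL_eq_signedImage {par : List Bool → Bool} {f : Bool → Bool} (h0 : par [] = true)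
    (h : ∀ c w, par (c :: w) = (par w ^^ f c)) (l : List Bool) :
    rhoL par l = signedImage f l := by
  induction l with
  | nil => rfl
  | cons c l ih =>
    rw [rhoL_cons, signedImage, h0, ← ih]
    have : (fun w => par (c :: w)) = fun w => par w ^^ f c := funext (h c)
    rw [this]
    cases hf : f c
    · have hid : sgT false = id := rfl
      simp [rhoImg, hid]
    · have hneg : sgT true = T3.negT := rfl
      simp [rhoImg, hneg, rhoL_not]

lemma flatten_map_tau01T (l : List Bool) :
    (l.map tau01T).flatten = signedImage (fun _ => false) l := by
  induction l with
  | nil => rfl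
  | cons c l ih =>
    have hid : sgT false = id := rfl
    simp only [List.map_cons, List.flatten_cons, ih, signedImage, hid]
    cases c <;> simp [tau01T]

lemma exists_eq_encode {σ : W2 → W3} (hσ : σ ∈ sigmaSet) : ∃ f, σ = encode f := by
  rcases hσ with rfl | rfl | rfl | rfl
  · refine ⟨fun c => !c, funext fun a => funext fun n => ?_⟩
    rw [rhoW, encode, rhoL_eq_signedImage (f := fun c => !c) rfl]
    intro c w
    cases c <;> simp [par0, Nat.even_add_one, -Nat.not_even_iff_odd]
  · refine ⟨fun c => c, funext fun a => funext fun n => ?_⟩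
    rw [rhoW, encode, rhoL_eq_signedImage (f := fun c => c) rfl]
    intro c w
    cases c <;> simp [par1, Nat.even_add_one, -Nat.not_even_iff_odd]
  · refine ⟨fun _ => true, funext fun a => funext fun n => ?_⟩
    rw [rhoW, encode, rhoL_eq_signedImage (f := fun _ => true) rfl]
    intro c w
    simp [par2, Nat.even_add_one, -Nat.not_even_iff_odd]
  · exact ⟨fun _ => false, funext fun a => funext fun n => by
      rw [subApply3, encode, flatten_map_tau01T]⟩

variable (f : Bool → Bool)

lemma getD_map_sgT (s : Bool) (l : List T3) (n : ℕ) :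
    (l.map (sgT s)).getD n T3.zer = sgT s (l.getD n T3.zer) := by
  conv_lhs => rw [← sgT_zer s]
  rw [List.getD_map]

lemma signedImage_append_getD (l l' : List Bool) (n : ℕ) (hn : n < l.length) :
    (signedImage f (l ++ l')).getD n T3.zer = (signedImage f l).getD n T3.zer := by
  induction l generalizing n with
  | nil => simp at hn
  | cons c l ih =>
    simp only [List.length_cons] at hn
    rw [List.cons_append, signedImage, signedImage]
    rcases n with _ | n
    · rfl
    · rw [List.getD_cons_succ, List.getD_cons_succ]
      cases c
      · simp only [Bool.false_eq_true, if_false, List.nil_append, getD_map_sgT]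
        rw [ih n (by omega)]
      · rcases n with _ | n
        · rfl
        · simp only [if_true, List.cons_append, List.nil_append, List.getD_cons_succ,
            getD_map_sgT]
          rw [ih n (by omega)]

lemma encode_eq_getD (a : W2) {n k : ℕ} (h : n < k) :
    encode f a n = (signedImage f (List.ofFn fun i : Fin k => a i.val)).getD n T3.zer := by
  obtain ⟨j, rfl⟩ := Nat.exists_eq_add_of_lt h
  rw [show n + j + 1 = (n + 1) + j by omega, List.ofFn_add, signedImage_append_getD]
  · rfl
  · simp

lemma encode_zero (a : W2) : encode f a 0 = T3.pos := by
  simp [encode, signedImage]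

lemma ofFn_shiftn (a : W2) (n : ℕ) :
    (List.ofFn fun i : Fin (n + 1) => a i.val) =
      a 0 :: List.ofFn fun i : Fin n => shiftn a 1 i.val := by
  simp [List.ofFn_succ, shiftn]

variable {f}

lemma encode_succ_of_false {a : W2} (h : a 0 = false) (n : ℕ) :
    encode f a (n + 1) = sgT (f false) (encode f (shiftn a 1) n) := by
  rw [encode, ofFn_shiftn, signedImage, h, List.getD_cons_succ]
  simp only [Bool.false_eq_true, if_false, List.nil_append, getD_map_sgT, encode]

lemma encode_one_of_true {a : W2} (h : a 0 = true) : encode f a 1 = T3.zer := by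
  rw [encode, ofFn_shiftn, signedImage, h, List.getD_cons_succ]
  simp

lemma encode_add_two_of_true {a : W2} (h : a 0 = true) (n : ℕ) :
    encode f a (n + 2) = sgT (f true) (encode f (shiftn a 1) n) := by
  rw [encode, ofFn_shiftn, signedImage, h, List.getD_cons_succ,
    encode_eq_getD f (shiftn a 1) (show n < n + 2 by omega)]
  simp only [if_true, List.cons_append, List.nil_append, List.getD_cons_succ, getD_map_sgT]

lemma encode_one_of_false {a : W2} (h : a 0 = false) :
    encode f a 1 = sgT (f false) T3.pos := by
  rw [encode_succ_of_false h, encode_zero]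

lemma encode_one_eq_iff {a b : W2} : encode f a 1 = encode f b 1 ↔ a 0 = b 0 := by
  have hne := sgT_pos_ne_zer (f false)
  rcases ha : a 0 <;> rcases hb : b 0 <;>
    simp [ha, hb, encode_one_of_false, encode_one_of_true, hne, hne.symm]

/-- Two binary words first differing at `k` have images first differing at some `n`, and the
cylinders of length `k` and `k + 1` correspond to cylinders of length `n` and `n + 1`. -/
lemma encode_first_diff (f : Bool → Bool) (k : ℕ) {p q : W2} (hag : AgreeTo k p q)
    (hk : p k ≠ q k) :
    ∃ n, AgreeTo n (encode f p) (encode f q) ∧ encode f p n ≠ encode f q n ∧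
      (∀ r, AgreeTo n (encode f p) (encode f r) → AgreeTo k p r) ∧
      (∀ r, AgreeTo (k + 1) p r → encode f p n = encode f r n) := by
  induction k generalizing p q with
  | zero =>
    refine ⟨1, fun m hm => ?_, fun h => hk (encode_one_eq_iff.mp h),
      fun _ _ m hm => by omega, fun r hr => encode_one_eq_iff.mpr (hr 0 (by omega))⟩
    obtain rfl : m = 0 := by omega
    rw [encode_zero, encode_zero]
  | succ k ih =>
    obtain ⟨n, h1, h2, h3, h4⟩ := ih (p := shiftn p 1) (q := shiftn q 1)
      (fun m hm => hag (m + 1) (by omega)) hk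
    have hn : 0 < n := by
      rcases n with _ | n
      · simp [encode_zero] at h2
      · omega
    have h00 := hag 0 (by omega)
    rcases hp0 : p 0
    · have hq0 : q 0 = false := h00 ▸ hp0
      refine ⟨n + 1, fun m hm => ?_, ?_, fun r hr => ?_, fun r hr => ?_⟩
      · rcases m with _ | m
        · rw [encode_zero, encode_zero]
        · rw [encode_succ_of_false hp0, encode_succ_of_false hq0, h1 m (by omega)]
      · rw [encode_succ_of_false hp0, encode_succ_of_false hq0]
        exact fun h => h2 (sgT_injective _ h)
      · have hr0 : p 0 = r 0 := encode_one_eq_iff.mp (hr 1 (by omega))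
        have := h3 (shiftn r 1) fun m hm => by
          have := hr (m + 1) (by omega)
          rw [encode_succ_of_false hp0, encode_succ_of_false (hr0 ▸ hp0)] at this
          exact sgT_injective _ this
        intro m hm
        rcases m with _ | m
        exacts [hr0, this m (by omega)]
      · have hr0 : p 0 = r 0 := hr 0 (by omega)
        rw [encode_succ_of_false hp0, encode_succ_of_false (hr0 ▸ hp0),
          h4 (shiftn r 1) fun m hm => hr (m + 1) (by omega)]
    · have hq0 : q 0 = true := h00 ▸ hp0
      refine ⟨n + 2, fun m hm => ?_, ?_, fun r hr => ?_, fun r hr => ?_⟩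
      · rcases m with _ | _ | m
        · rw [encode_zero, encode_zero]
        · rw [encode_one_of_true hp0, encode_one_of_true hq0]
        · rw [encode_add_two_of_true hp0, encode_add_two_of_true hq0, h1 m (by omega)]
      · rw [encode_add_two_of_true hp0, encode_add_two_of_true hq0]
        exact fun h => h2 (sgT_injective _ h)
      · have hr0 : p 0 = r 0 := encode_one_eq_iff.mp (hr 1 (by omega))
        have := h3 (shiftn r 1) fun m hm => by
          have := hr (m + 2) (by omega)
          rw [encode_add_two_of_true hp0, encode_add_two_of_true (hr0 ▸ hp0)] at this
          exact sgT_injective _ this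
        intro m hm
        rcases m with _ | m
        exacts [hr0, this m (by omega)]
      · have hr0 : p 0 = r 0 := hr 0 (by omega)
        rw [encode_add_two_of_true hp0, encode_add_two_of_true (hr0 ▸ hp0),
          h4 (shiftn r 1) fun m hm => hr (m + 1) (by omega)]

lemma encode_injective (f : Bool → Bool) : Function.Injective (encode f) := by
  intro p q h
  by_contra hne
  obtain ⟨k, hag, hk⟩ := exists_first_diff hne
  obtain ⟨n, -, hn, -⟩ := encode_first_diff f k hag hk
  exact hn (congrFun h n)

lemma agreeTo_encode (f : Bool → Bool) {n : ℕ} {p q : W2} (h : AgreeTo n p q) :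
    AgreeTo n (encode f p) (encode f q) := by
  intro m hm
  rw [encode_eq_getD f p hm, encode_eq_getD f q hm]
  congr 3
  funext i
  exact h i i.2

lemma agreeTo_of_encode {n : ℕ} {p q : W2}
    (h : AgreeTo (2 * n) (encode f p) (encode f q)) : AgreeTo n p q := by
  induction n generalizing p q with
  | zero => exact fun m hm => by omega
  | succ n ih =>
    have h0 : p 0 = q 0 := encode_one_eq_iff.mp (h 1 (by omega))
    have : AgreeTo n (shiftn p 1) (shiftn q 1) := by
      refine ih fun m hm => ?_
      rcases hp0 : p 0
      · have := h (m + 1) (by omega)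
        rw [encode_succ_of_false hp0, encode_succ_of_false (h0 ▸ hp0)] at this
        exact sgT_injective _ this
      · have := h (m + 2) (by omega)
        rw [encode_add_two_of_true hp0, encode_add_two_of_true (h0 ▸ hp0)] at this
        exact sgT_injective _ this
    intro m hm
    rcases m with _ | m
    exacts [h0, this m (by omega)]

end Encoding

section SignedTails

lemma eq_sgT_pos_of_ne_zer {x : T3} (h : x ≠ T3.zer) : ∃ s, x = sgT s T3.pos := by
  cases x
  exacts [⟨true, rfl⟩, absurd rfl h, ⟨false, rfl⟩]

lemma absW_of_pos {a : W3} (h : a 0 = T3.pos) : absW a = a :=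
  if_pos (Or.inr ⟨0, fun m hm => absurd hm m.not_lt_zero, by simp [t3lt, h, zeroW3, T3.toInt]⟩)

lemma absW_of_neg {a : W3} (h : a 0 = T3.neg) : absW a = negW a := by
  refine if_neg ?_
  rintro (h0 | ⟨i, hi, hlt⟩)
  · rw [← h0] at h
    cases h
  · rcases i with _ | i
    · simp [t3lt, h, zeroW3, T3.toInt] at hlt
    · have := hi 0 i.succ_pos
      rw [h] at this
      cases this

lemma absW_zero_of_zer {a : W3} (h : a 0 = T3.zer) : absW a 0 = T3.zer := by
  unfold absW
  split_ifs <;> simp [negW, h, T3.negT]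

lemma absW_zero_of_ne_zer {a : W3} (h : a 0 ≠ T3.zer) : absW a 0 = T3.pos := by
  rcases ha : a 0
  · simp [absW_of_neg ha, negW, ha, T3.negT]
  · exact absurd ha h
  · rw [absW_of_pos ha, ha]

lemma absW_sgW (s : Bool) {a : W3} (h : a 0 = T3.pos) : absW (sgW s a) = a := by
  cases s
  · exact absW_of_pos h
  · have h0 : sgW true a 0 = T3.neg := by simp [sgW, h, T3.negT]
    rw [absW_of_neg h0]
    funext n
    simp [negW, sgW]

lemma exists_absW_eq_sgW {a : W3} (h : a 0 ≠ T3.zer) : ∃ s, a = sgW s (absW a) := by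
  rcases ha : a 0
  · exact ⟨true, by rw [absW_of_neg ha]; funext n; simp [sgW, negW]⟩
  · exact absurd ha h
  · exact ⟨false, by rw [absW_of_pos ha]; rfl⟩

lemma sgW_sgW (s t : Bool) (a : W3) : sgW s (sgW t a) = sgW (s ^^ t) a := by
  funext n
  cases s <;> cases t <;> simp [sgW]

lemma sgW_sgW_self (s : Bool) (a : W3) : sgW s (sgW s a) = a := funext fun _ => sgT_sgT s _

lemma shiftn_shiftn {A : Type*} (a : ℕ → A) (j k : ℕ) :
    shiftn (shiftn a j) k = shiftn a (k + j) :=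
  funext fun n => congrArg a (Nat.add_assoc n k j)

lemma shiftn_sgW (s : Bool) (a : W3) (k : ℕ) : shiftn (sgW s a) k = sgW s (shiftn a k) := rfl

lemma shiftn_encode_one {f : Bool → Bool} {b : W2} (h : b 0 = false) :
    shiftn (encode f b) 1 = sgW (f false) (encode f (shiftn b 1)) :=
  funext fun n => encode_succ_of_false h n

lemma shiftn_encode_two {f : Bool → Bool} {b : W2} (h : b 0 = true) :
    shiftn (encode f b) 2 = sgW (f true) (encode f (shiftn b 1)) :=
  funext fun n => encode_add_two_of_true h n

lemma shiftn_encode_cases (f : Bool → Bool) (b : W2) (k : ℕ) :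
    shiftn (encode f b) k 0 = T3.zer ∨
      ∃ s j, shiftn (encode f b) k = sgW s (encode f (shiftn b j)) := by
  induction k using Nat.strong_induction_on generalizing b with
  | _ k ih =>
    have key : ∀ i < k, ∀ s, shiftn (encode f b) k =
        shiftn (sgW s (encode f (shiftn b 1))) i → shiftn (encode f b) k 0 = T3.zer ∨
          ∃ s j, shiftn (encode f b) k = sgW s (encode f (shiftn b j)) := by
      intro i hi s h
      rw [h, shiftn_sgW]
      rcases ih i hi (shiftn b 1) with hz | ⟨t, j, hj⟩
      · exact Or.inl (by rw [sgW, hz, sgT_zer])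
      · exact Or.inr ⟨s ^^ t, j + 1, by rw [hj, sgW_sgW, shiftn_shiftn]⟩
    rcases k with _ | k
    · exact Or.inr ⟨false, 0, rfl⟩
    · rcases hb : b 0
      · refine key k (by omega) (f false) ?_
        rw [← shiftn_encode_one hb, shiftn_shiftn]
      · rcases k with _ | k
        · exact Or.inl (encode_one_of_true hb)
        · refine key k (by omega) (f true) ?_
          rw [← shiftn_encode_two hb, shiftn_shiftn]

lemma exists_shiftn_encode (f : Bool → Bool) (b : W2) (j : ℕ) :
    ∃ k s, shiftn (encode f b) k = sgW s (encode f (shiftn b j)) := by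
  induction j generalizing b with
  | zero => exact ⟨0, false, rfl⟩
  | succ j ih =>
    obtain ⟨k, s, h⟩ := ih (shiftn b 1)
    rw [shiftn_shiftn] at h
    rcases hb : b 0
    · refine ⟨k + 1, f false ^^ s, ?_⟩
      rw [← shiftn_shiftn, shiftn_encode_one hb, shiftn_sgW, h, sgW_sgW]
    · refine ⟨k + 2, f true ^^ s, ?_⟩
      rw [← shiftn_shiftn, shiftn_encode_two hb, shiftn_sgW, h, sgW_sgW]

lemma encode_mem_absTails {f : Bool → Bool} {a : W3} {k : ℕ} {s : Bool} {b : W2}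
    (h : shiftn a k = sgW s (encode f b)) (j : ℕ) :
    encode f (shiftn b j) ∈ absTails a := by
  obtain ⟨i, t, hi⟩ := exists_shiftn_encode f b j
  refine ⟨i + k, ?_⟩
  rw [← shiftn_shiftn, h, shiftn_sgW, hi, sgW_sgW, absW_sgW _ (encode_zero f _)]

lemma absTails_cases {f : Bool → Bool} {a : W3} {k : ℕ} {s : Bool} {b : W2}
    (h : shiftn a k = sgW s (encode f b)) (hz : ∀ i < k, a i = T3.zer) {x : W3}
    (hx : x ∈ absTails a) : x 0 = T3.zer ∨ ∃ j, x = encode f (shiftn b j) := by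
  obtain ⟨i, rfl⟩ := hx
  rcases lt_or_ge i k with hik | hik
  · exact Or.inl (absW_zero_of_zer (by simpa [shiftn] using hz i hik))
  · obtain ⟨i, rfl⟩ := Nat.exists_eq_add_of_le' hik
    rw [← shiftn_shiftn, h, shiftn_sgW]
    rcases shiftn_encode_cases f b i with h0 | ⟨t, j, hj⟩
    · exact Or.inl (absW_zero_of_zer (by rw [sgW, h0, sgT_zer]))
    · exact Or.inr ⟨j, by rw [hj, sgW_sgW, absW_sgW _ (encode_zero f _)]⟩

end SignedTails

section Decoding

variable (f : Bool → Bool)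

/-- If `c` starts with a nonzero letter, then its next letters are those of a signed image. -/
def LocallyAdmissible (c : W3) : Prop :=
  ∀ s, c 0 = sgT s T3.pos →
    c 1 = sgT s (sgT (f false) T3.pos) ∨ c 1 = T3.zer ∧ c 2 = sgT s (sgT (f true) T3.pos)

/-- Every tail is locally admissible. -/
def Admissible (a : W3) : Prop := ∀ k, LocallyAdmissible f (shiftn a k)

/-- Remove the image of the first letter and normalize the sign of what remains. -/
def decodeStep (a : W3) : W3 :=
  if a 1 = T3.zer then sgW (f true) (shiftn a 2) else sgW (f false) (shiftn a 1)

/-- The binary word encoded by an admissible word starting with `1`. -/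
def decode (a : W3) : W2 := fun j => decide ((decodeStep f)^[j] a 1 = T3.zer)

variable {f}

lemma LocallyAdmissible.sgW {c : W3} (h : LocallyAdmissible f c) (s : Bool) :
    LocallyAdmissible f (sgW s c) := by
  intro t ht
  have hx : ∀ x, sgT s (sgT (s ^^ t) x) = sgT t x := by
    intro x
    cases s <;> cases t <;> simp
  have h0 : c 0 = sgT (s ^^ t) T3.pos := by
    refine sgT_injective s ?_
    rw [hx]
    exact ht
  rcases h _ h0 with h1 | ⟨h1, h2⟩
  · exact Or.inl (by rw [_root_.sgW, h1, hx])
  · exact Or.inr ⟨by rw [_root_.sgW, h1, sgT_zer], by rw [_root_.sgW, h2, hx]⟩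

lemma LocallyAdmissible.congr {c d : W3} (h : LocallyAdmissible f c) (hcd : AgreeTo 3 c d) :
    LocallyAdmissible f d := by
  intro s hs
  have := h s
  rwa [hcd 0 (by omega), hcd 1 (by omega), hcd 2 (by omega), imp_iff_right hs] at this

lemma Admissible.sgW {a : W3} (h : Admissible f a) (s : Bool) : Admissible f (sgW s a) :=
  fun k => (h k).sgW s

lemma Admissible.shiftn {a : W3} (h : Admissible f a) (k : ℕ) : Admissible f (shiftn a k) :=
  fun j => by rw [shiftn_shiftn]; exact h _

lemma locallyAdmissible_encode (b : W2) : LocallyAdmissible f (encode f b) := by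
  intro s hs
  rw [encode_zero] at hs
  obtain rfl : s = false := by
    cases s
    · rfl
    · cases hs
  rcases hb : b 0
  · exact Or.inl (encode_one_of_false hb)
  · refine Or.inr ⟨encode_one_of_true hb, ?_⟩
    rw [encode_add_two_of_true hb, encode_zero]
    rfl

lemma admissible_encode (b : W2) : Admissible f (encode f b) := by
  intro k
  rcases shiftn_encode_cases f b k with h | ⟨s, j, h⟩
  · intro s hs
    rw [h] at hs
    exact absurd hs.symm (sgT_pos_ne_zer s)
  · rw [h]
    exact (locallyAdmissible_encode _).sgW s

lemma admissible_of_closure {a : W3} (h : ∀ n, ∃ b, AgreeTo n a (encode f b)) :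
    Admissible f a := by
  intro k
  obtain ⟨b, hb⟩ := h (k + 3)
  exact (admissible_encode b k).congr fun m hm => (hb (m + k) (by omega)).symm

lemma encode_decode {a : W3} (h0 : a 0 = T3.pos) (ha : Admissible f a) :
    encode f (decode f a) = a := by
  refine eq_of_forall_agreeTo fun n => ?_
  induction n using Nat.strong_induction_on generalizing a with
  | _ n ih =>
    have hsh : shiftn (decode f a) 1 = decode f (decodeStep f a) := rfl
    have hd0 : decode f a 0 = decide (a 1 = T3.zer) := rfl
    intro m hm
    rcases m with _ | m
    · rw [encode_zero, h0]
    · by_cases h1 : a 1 = T3.zer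
      · rw [decide_eq_true h1] at hd0
        have hstep : decodeStep f a = sgW (f true) (shiftn a 2) := if_pos h1
        have h2 : a 2 = sgT (f true) T3.pos := by
          rcases ha 0 false h0 with h | h
          · exact absurd (h.symm.trans h1) (sgT_pos_ne_zer _)
          · exact h.2
        rcases m with _ | m
        · rw [encode_one_of_true hd0, h1]
        · have hz : decodeStep f a 0 = T3.pos := by
            rw [hstep]
            simp [sgW, shiftn, h2]
          rw [encode_add_two_of_true hd0, hsh, ih (n - 1) (by omega) hz
            (hstep ▸ (ha.shiftn 2).sgW _) m (by omega), hstep]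
          exact sgT_sgT _ _
      · rw [decide_eq_false h1] at hd0
        have hstep : decodeStep f a = sgW (f false) (shiftn a 1) := if_neg h1
        have h2 : a 1 = sgT (f false) T3.pos :=
          (ha 0 false h0).resolve_right fun h => h1 h.1
        have hz : decodeStep f a 0 = T3.pos := by
          rw [hstep]
          simp [sgW, shiftn, h2]
        rw [encode_succ_of_false hd0, hsh, ih (n - 1) (by omega) hz
          (hstep ▸ (ha.shiftn 1).sgW _) m (by omega), hstep]
        exact sgT_sgT _ _

end Decoding

section TreeOrder

/-- The order `-1 < 0 < 1` on letters if `g` holds, and its reverse otherwise. -/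
def branchLt (g : Prop) (x y : T3) : Prop := if g then t3lt x y else t3lt y x

lemma t3lt_trichotomy {x y : T3} (h : x ≠ y) : t3lt x y ∨ t3lt y x := by
  cases x <;> cases y <;> simp_all [t3lt, T3.toInt]

lemma branchLt_irrefl (g : Prop) (x : T3) : ¬ branchLt g x x := by
  unfold branchLt
  split_ifs <;> exact lt_irrefl _

lemma branchLt_trans {g : Prop} {x y z : T3} (h : branchLt g x y) (h' : branchLt g y z) :
    branchLt g x z := by
  unfold branchLt at *
  split_ifs at *
  exacts [lt_trans h h', lt_trans h' h]

lemma branchLt_trichotomy {g : Prop} {x y : T3} (h : x ≠ y) :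
    branchLt g x y ∨ branchLt g y x := by
  unfold branchLt
  split_ifs
  exacts [t3lt_trichotomy h, (t3lt_trichotomy h).symm]

/-- The strict order on infinite words which, at the first difference `n` of `a` and `b`,
compares the letters increasingly if `G a n` holds and decreasingly otherwise. -/
def treeLt (G : W3 → ℕ → Prop) (a b : W3) : Prop :=
  ∃ n, AgreeTo n a b ∧ branchLt (G a n) (a n) (b n)

/-- The reflexive closure of `treeLt`. -/
def treeLe (G : W3 → ℕ → Prop) (a b : W3) : Prop := a = b ∨ treeLt G a b

variable {G : W3 → ℕ → Prop}

lemma ne_of_branchLt {g : Prop} {x y : T3} (h : branchLt g x y) : x ≠ y :=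
  fun hxy => branchLt_irrefl g y (hxy ▸ h)

lemma treeLe_iff {a b : W3} {n : ℕ} (hag : AgreeTo n a b) (hne : a n ≠ b n) :
    treeLe G a b ↔ branchLt (G a n) (a n) (b n) := by
  refine ⟨?_, fun h => Or.inr ⟨n, hag, h⟩⟩
  rintro (rfl | ⟨m, hm, h⟩)
  · exact absurd rfl hne
  · rcases lt_trichotomy m n with hmn | rfl | hmn
    · exact absurd (hag m hmn) (ne_of_branchLt h)
    · exact h
    · exact absurd (hm n hmn) hne

lemma isCylOrder_treeLe (hG : ∀ a b n, AgreeTo n a b → (G a n ↔ G b n)) :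
    IsCylOrder (treeLe G) := by
  have total : ∀ a b, treeLe G a b ∨ treeLe G b a := by
    intro a b
    by_cases hab : a = b
    · exact Or.inl (Or.inl hab)
    · obtain ⟨n, hag, hne⟩ := exists_first_diff hab
      rw [treeLe_iff hag hne, treeLe_iff hag.symm hne.symm, hG b a n hag.symm]
      exact branchLt_trichotomy hne
  have antisymm : ∀ a b, treeLe G a b → treeLe G b a → a = b := by
    intro a b h h'
    by_contra hab
    obtain ⟨n, hag, hne⟩ := exists_first_diff hab
    rw [treeLe_iff hag hne] at h
    rw [treeLe_iff hag.symm hne.symm, hG b a n hag.symm] at h'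
    exact branchLt_irrefl _ _ (branchLt_trans h h')
  have trans : ∀ a b c, treeLt G a b → treeLt G b c →
      treeLt G a c ∧ ∀ n, AgreeTo n a c → AgreeTo n a b := by
    rintro a b c ⟨n, hn, h⟩ ⟨m, hm, h'⟩
    rcases lt_trichotomy n m with hnm | rfl | hnm
    · have h1 : branchLt (G a n) (a n) (c n) := hm n hnm ▸ h
      refine ⟨⟨n, hn.trans (hm.mono hnm.le), h1⟩, fun k hk => hn.mono ?_⟩
      by_contra! hlt
      exact ne_of_branchLt h1 (hk n hlt)
    · rw [hG b a n hn.symm] at h'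
      have h1 := branchLt_trans h h'
      refine ⟨⟨n, hn.trans hm, h1⟩, fun k hk => hn.mono ?_⟩
      by_contra! hlt
      exact ne_of_branchLt h1 (hk n hlt)
    · rw [hG b a m (hn.mono hnm.le).symm, ← hn m hnm] at h'
      refine ⟨⟨m, (hn.mono hnm.le).trans hm, h'⟩, fun k hk => hn.mono ?_⟩
      by_contra! hlt
      exact ne_of_branchLt h' (hk m (hnm.trans hlt))
  refine ⟨total, antisymm, ?_, ?_⟩
  · rintro a b c (rfl | h) (rfl | h')
    exacts [Or.inl rfl, Or.inr h', Or.inr h, Or.inr (trans a b c h h').1]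
  · intro a b c hab hbc
    refine wdist_le_of_agreeTo fun n hn => ?_
    rcases hab with rfl | hab
    · exact fun _ _ => rfl
    · rcases hbc with rfl | hbc
      exacts [hn, (trans a b c hab hbc).2 n hn]

lemma inCyl_append_singleton {w : List T3} {x : T3} {a : W3} (h : inCyl (w ++ [x]) a) :
    (∀ m (hm : m < w.length), a m = w[m]) ∧ a w.length = x := by
  refine ⟨fun m hm => ?_, ?_⟩
  · have := h ⟨m, by simp; omega⟩
    simpa [List.getElem_append_left hm] using this
  · have := h ⟨w.length, by simp⟩
    simpa using this

lemma consistent_treeLe (hG : ∀ a b n, AgreeTo n a b → (G a n ↔ G b n)) :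
    Consistent (treeLe G) := by
  intro w
  let u : W3 := fun n => w.getD n T3.zer
  have key : ∀ x y, branchLt (G u w.length) x y →
      cylLt (treeLe G) (w ++ [x]) (w ++ [y]) := by
    intro x y hxy a b ha hb
    obtain ⟨ha', rfl⟩ := inCyl_append_singleton ha
    obtain ⟨hb', rfl⟩ := inCyl_append_singleton hb
    have hua : AgreeTo w.length u a := fun m hm => by simp [u, ha' m hm, hm]
    have hab : AgreeTo w.length a b := fun m hm => by rw [ha' m hm, hb' m hm]
    rw [hG u a _ hua] at hxy
    exact ⟨Or.inr ⟨_, hab, hxy⟩, fun h => ne_of_branchLt hxy (congrFun h _)⟩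
  by_cases hg : G u w.length
  · left
    constructor <;> apply key <;> simp [branchLt, hg, t3lt, T3.toInt]
  · right
    constructor <;> apply key <;> simp [branchLt, hg, t3lt, T3.toInt]

end TreeOrder

section Pushforward

variable {f : Bool → Bool} {le' : W2 → W2 → Prop}

/-- Whether the letters following the first `n` letters of `a` are ordered increasingly, in the
order on `{0,±1}^∞` that extends the pushforward of `le'` under `encode f`. The choice at the
word `10` makes the image of `encode f` smaller than all other words starting with `1`. -/
def ascending (f : Bool → Bool) (le' : W2 → W2 → Prop) (a : W3) (n : ℕ) : Prop :=
  if n = 2 ∧ a 0 = T3.pos ∧ a 1 = T3.zer then f true = true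
  else ∀ p q, AgreeTo n a (encode f p) → AgreeTo n a (encode f q) →
    t3lt (encode f p n) (encode f q n) → le' p q

lemma ascending_congr (a b : W3) (n : ℕ) (h : AgreeTo n a b) :
    ascending f le' a n ↔ ascending f le' b n := by
  have hc : (n = 2 ∧ a 0 = T3.pos ∧ a 1 = T3.zer) ↔ (n = 2 ∧ b 0 = T3.pos ∧ b 1 = T3.zer) :=
    and_congr_right fun hn => by rw [h 0 (by omega), h 1 (by omega)]
  have ha : ∀ p, AgreeTo n a (encode f p) ↔ AgreeTo n b (encode f p) :=
    fun p => ⟨h.symm.trans, h.trans⟩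
  simp only [ascending, hc, ha]

lemma ascending_zero (a : W3) : ascending f le' a 0 := by
  rw [ascending, if_neg (by omega)]
  intro p q _ _ h
  simp [encode_zero, t3lt] at h

lemma ascending_one (h' : IsCylOrder le') (h01 : wlt le' w0 w1) {a : W3}
    (h0 : a 0 = T3.pos) : ascending f le' a 1 ↔ f false = true := by
  have hle : ∀ {p q : W2}, p 0 = false → q 0 = true → le' p q := fun hp hq =>
    h'.le_congr (k := 0) h01.1 (by simp [w0, w1])
      (fun m hm => by obtain rfl : m = 0 := by omega
                      exact hp.symm)
      (fun m hm => by obtain rfl : m = 0 := by omega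
                      exact hq.symm)
  have hag : ∀ p, AgreeTo 1 a (encode f p) := fun p m hm => by
    obtain rfl : m = 0 := by omega
    rw [h0, encode_zero]
  rw [ascending, if_neg (by omega)]
  rcases hf : f false
  · simp only [Bool.false_eq_true, iff_false]
    intro h
    have h10 := h w1 w0 (hag _) (hag _) (by
      rw [encode_one_of_true rfl, encode_one_of_false rfl, hf]
      simp [t3lt, T3.toInt])
    exact h01.2 (h'.2.1 _ _ h01.1 h10)
  · simp only [iff_true]
    intro p q _ _ hlt
    rcases hp : p 0 <;> rcases hq : q 0
    · simp [encode_one_of_false hp, encode_one_of_false hq, t3lt] at hlt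
    · exact hle hp hq
    · simp [encode_one_of_true hp, encode_one_of_false hq, hf, t3lt, T3.toInt, T3.negT] at hlt
    · simp [encode_one_of_true hp, encode_one_of_true hq, t3lt] at hlt

lemma ascending_two {a : W3} (h0 : a 0 = T3.pos) (h1 : a 1 = T3.zer) :
    ascending f le' a 2 ↔ f true = true := by
  rw [ascending, if_pos ⟨rfl, h0, h1⟩]

lemma branchLt_of_eq_sgT {g : Prop} {s : Bool} {x : T3} (hg : g ↔ s = true)
    (hx : x ≠ sgT s T3.pos) : branchLt g (sgT s T3.pos) x := by
  rw [branchLt, if_congr hg rfl rfl]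
  cases s <;> cases x <;> simp_all [t3lt, T3.toInt, T3.negT]

lemma branchLt_of_eq_zer {g : Prop} {s : Bool} {x : T3} (hg : g ↔ s = true)
    (hx : x ≠ sgT s T3.pos) (hz : x ≠ T3.zer) : branchLt g T3.zer x := by
  rw [branchLt, if_congr hg rfl rfl]
  cases s <;> cases x <;> simp_all [t3lt, T3.toInt, T3.negT]

lemma treeLt_of_locallyAdmissible (h' : IsCylOrder le') (h01 : wlt le' w0 w1) {a b : W3}
    (ha0 : a 0 = T3.pos) (hb0 : b 0 = T3.pos) (ha : LocallyAdmissible f a)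
    (hb : ¬ LocallyAdmissible f b) : treeLt (ascending f le') a b := by
  have hb' : b 1 ≠ sgT (f false) T3.pos ∧ (b 1 = T3.zer → b 2 ≠ sgT (f true) T3.pos) := by
    constructor
    · refine fun h => hb fun s hs => Or.inl ?_
      obtain rfl : s = false := sgT_pos_injective (hs.symm.trans hb0)
      exact h
    · refine fun h1 h => hb fun s hs => Or.inr ⟨h1, ?_⟩
      obtain rfl : s = false := sgT_pos_injective (hs.symm.trans hb0)
      exact h
  have hag : AgreeTo 1 a b := fun m hm => by
    obtain rfl : m = 0 := by omega
    rw [ha0, hb0]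
  rcases ha false ha0 with h1 | ⟨h1, h2⟩
  · refine ⟨1, hag, ?_⟩
    rw [h1]
    exact branchLt_of_eq_sgT (ascending_one h' h01 ha0) hb'.1
  · by_cases hb1 : b 1 = T3.zer
    · refine ⟨2, hag.succ (h1.trans hb1.symm), ?_⟩
      rw [h2]
      exact branchLt_of_eq_sgT (ascending_two ha0 h1) (hb'.2 hb1)
    · refine ⟨1, hag, ?_⟩
      rw [h1]
      exact branchLt_of_eq_zer (ascending_one h' h01 ha0) hb'.1 hb1

lemma treeLt_of_ne_pos {a b : W3} (ha : a 0 ≠ T3.pos) (hb : b 0 = T3.pos) :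
    treeLt (ascending f le') a b := by
  refine ⟨0, fun m hm => absurd hm m.not_lt_zero, ?_⟩
  rw [branchLt, if_pos (ascending_zero a), hb]
  rcases h : a 0 <;> simp_all [t3lt, T3.toInt]

lemma treeLe_encode_iff (h' : IsCylOrder le') {p q : W2} :
    treeLe (ascending f le') (encode f p) (encode f q) ↔ le' p q := by
  have hord := isCylOrder_treeLe (ascending_congr (f := f) (le' := le'))
  suffices h : ∀ {p q : W2}, le' p q → treeLe (ascending f le') (encode f p) (encode f q) by
    refine ⟨fun hpq => (h'.1 p q).elim id fun hqp => ?_, h⟩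
    exact encode_injective f (hord.2.1 _ _ hpq (h hqp)) ▸ h'.refl p
  intro p q hle
  by_cases hpq : p = q
  · exact Or.inl (congrArg _ hpq)
  obtain ⟨k, hag, hk⟩ := exists_first_diff hpq
  obtain ⟨n, hn, hne, h1, h2⟩ := encode_first_diff f k hag hk
  have h2' : ∀ r, AgreeTo (k + 1) q r → encode f q n = encode f r n := by
    obtain ⟨n', hn', hne', -, h4⟩ := encode_first_diff f k hag.symm hk.symm
    obtain rfl : n = n' := by
      rcases lt_trichotomy n n' with h | h | h
      · exact absurd (hn' n h).symm hne
      · exact h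
      · exact absurd (hn n' h).symm hne'
    exact h4
  refine (treeLe_iff hn hne).mpr ?_
  by_cases hc : n = 2 ∧ encode f p 0 = T3.pos ∧ encode f p 1 = T3.zer
  · obtain ⟨rfl, -, hp1⟩ := hc
    have hq1 : encode f q 1 = T3.zer := by rw [← hn 1 (by omega), hp1]
    have aux : ∀ {r}, encode f r 1 = T3.zer → encode f r 2 = sgT (f true) T3.pos := by
      intro r hr
      have hr0 : r 0 = true := by
        rcases hr0 : r 0
        · exact absurd ((encode_one_of_false hr0).symm.trans hr) (sgT_pos_ne_zer _)
        · rfl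
      rw [encode_add_two_of_true hr0, encode_zero]
    exact absurd ((aux hp1).trans (aux hq1).symm) hne
  · rw [branchLt, ascending, if_neg hc]
    have hsplit : ∀ r, AgreeTo n (encode f p) (encode f r) →
        AgreeTo (k + 1) p r ∨ AgreeTo (k + 1) q r := by
      intro r hr
      have hkr := h1 r hr
      by_cases hrk : p k = r k
      · exact Or.inl (hkr.succ hrk)
      · refine Or.inr ((hag.symm.trans hkr).succ ?_)
        revert hk hrk
        cases p k <;> cases q k <;> cases r k <;> simp
    split_ifs with hg
    · refine (t3lt_trichotomy hne).resolve_right fun hlt => ?_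
      exact hpq (h'.2.1 _ _ hle (hg q p hn (fun _ _ => rfl) hlt))
    · refine (t3lt_trichotomy hne).resolve_left fun hlt => hg fun r t hr ht hrt => ?_
      rcases hsplit r hr with hr | hr <;> rcases hsplit t ht with ht | ht
      · rw [← h2 r hr, ← h2 t ht] at hrt
        exact absurd hrt (lt_irrefl _)
      · exact h'.le_congr hle hk hr ht
      · rw [← h2' r hr, ← h2 t ht] at hrt
        exact absurd hrt (lt_asymm hlt)
      · rw [← h2' r hr, ← h2' t ht] at hrt
        exact absurd hrt (lt_irrefl _)

end Pushforward

section SupWords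

instance : Finite T3 :=
  Finite.of_surjective ![T3.neg, T3.zer, T3.pos] fun x => by
    cases x
    exacts [⟨0, rfl⟩, ⟨1, rfl⟩, ⟨2, rfl⟩]

lemma tails_nonempty {A : Type*} (a : ℕ → A) : (tails a).Nonempty := ⟨_, 0, rfl⟩

lemma absTails_nonempty (a : W3) : (absTails a).Nonempty := ⟨_, 0, rfl⟩

variable {f : Bool → Bool} {le' : W2 → W2 → Prop}

lemma encode_mem_MAbs (h' : IsCylOrder le') {m : W2}
    (hm : m ∈ supWords le') : encode f m ∈ MAbs (treeLe (ascending f le')) := by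
  obtain ⟨a, ha⟩ := hm
  refine ⟨encode f a, (isCylOrder_treeLe ascending_congr).isSupOf_of_agreeTo ?_ ?_⟩
  · intro x hx
    rcases absTails_cases (k := 0) (s := false) rfl (fun i hi => absurd hi i.not_lt_zero) hx
      with h0 | ⟨j, rfl⟩
    · exact Or.inr (treeLt_of_ne_pos (by simp [h0]) (encode_zero f m))
    · exact (treeLe_encode_iff h').mpr (ha.1 _ ⟨j, rfl⟩)
  · intro n
    obtain ⟨_, ⟨j, rfl⟩, hj⟩ := h'.exists_agreeTo_of_isSupOf (tails_nonempty a) ha n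
    exact ⟨_, encode_mem_absTails (k := 0) (s := false) rfl j, agreeTo_encode f hj⟩

lemma eq_zeroW3_of_mem_MAbs {y : W3} (hy : y ∈ MAbs (treeLe (ascending f le')))
    (h0 : y 0 ≠ T3.pos) : y = zeroW3 := by
  obtain ⟨a, ha⟩ := hy
  have hord := isCylOrder_treeLe (ascending_congr (f := f) (le' := le'))
  have hz : ∀ k, a k = T3.zer := by
    intro k
    by_contra hk
    have hk' : shiftn a k 0 ≠ T3.zer := by simpa [shiftn] using hk
    have hpos := absW_zero_of_ne_zer hk'
    have := hord.2.1 _ _ (ha.1 _ ⟨k, rfl⟩) (Or.inr (treeLt_of_ne_pos h0 hpos))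
    exact h0 (this ▸ hpos)
  refine eq_of_forall_agreeTo fun n m hm => ?_
  obtain ⟨_, ⟨k, rfl⟩, hk⟩ := hord.exists_agreeTo_of_isSupOf (absTails_nonempty a) ha n
  rw [hk m hm, zeroW3, absW]
  split_ifs <;> simp [negW, shiftn, hz, T3.negT]

lemma exists_eq_encode_of_mem_MAbs (h' : IsCylOrder le') (h01 : wlt le' w0 w1) {y : W3}
    (hy : y ∈ MAbs (treeLe (ascending f le'))) (h0 : y 0 = T3.pos)
    (hadm : LocallyAdmissible f y) : ∃ m ∈ supWords le', y = encode f m := by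
  obtain ⟨a, ha⟩ := hy
  have hord := isCylOrder_treeLe (ascending_congr (f := f) (le' := le'))
  have hclosure := hord.exists_agreeTo_of_isSupOf (absTails_nonempty a) ha
  have hloc : Admissible f a := by
    intro k
    by_cases hk : shiftn a k 0 = T3.zer
    · intro s hs
      rw [hk] at hs
      exact absurd hs.symm (sgT_pos_ne_zer s)
    · obtain ⟨s, hs⟩ := exists_absW_eq_sgW hk
      have hpos := absW_zero_of_ne_zer hk
      rw [hs]
      refine LocallyAdmissible.sgW ?_ s
      by_contra hbad
      have := hord.2.1 _ _ (ha.1 _ ⟨k, rfl⟩)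
        (Or.inr (treeLt_of_locallyAdmissible h' h01 h0 hpos hadm hbad))
      exact hbad (this ▸ hadm)
  have hex : ∃ k, a k ≠ T3.zer := by
    by_contra! hz
    obtain ⟨_, ⟨k, rfl⟩, hk⟩ := hclosure 1
    have h := hk 0 one_pos
    rw [h0, absW_zero_of_zer (by simp [shiftn, hz])] at h
    cases h
  obtain ⟨k, hk, hmin⟩ : ∃ k, a k ≠ T3.zer ∧ ∀ i < k, a i = T3.zer :=
    ⟨Nat.find hex, Nat.find_spec hex, fun i hi => not_not.mp (Nat.find_min hex hi)⟩
  obtain ⟨b, s, hb⟩ : ∃ b s, shiftn a k = sgW s (encode f b) := by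
    obtain ⟨s, hs⟩ := eq_sgT_pos_of_ne_zer hk
    refine ⟨decode f (sgW s (shiftn a k)), s, ?_⟩
    rw [encode_decode (by simp [sgW, shiftn, hs]) ((hloc.shiftn k).sgW s), sgW_sgW_self]
  have hcl : ∀ n, ∃ j, AgreeTo n y (encode f (shiftn b j)) := by
    intro n
    obtain ⟨x, hx, hxn⟩ := hclosure (n + 1)
    rcases absTails_cases hb hmin hx with hx0 | ⟨j, rfl⟩
    · have h := hxn 0 n.succ_pos
      rw [h0, hx0] at h
      cases h
    · exact ⟨j, hxn.mono n.le_succ⟩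
  have hdec : encode f (decode f y) = y :=
    encode_decode h0 (admissible_of_closure fun n => (hcl n).elim fun j hj => ⟨_, hj⟩)
  refine ⟨decode f y, ⟨b, h'.isSupOf_of_agreeTo ?_ fun n => ?_⟩, hdec.symm⟩
  · rintro _ ⟨j, rfl⟩
    rw [← treeLe_encode_iff (f := f) h', hdec]
    exact ha.1 _ (encode_mem_absTails hb j)
  · obtain ⟨j, hj⟩ := hcl (2 * n)
    exact ⟨_, ⟨j, rfl⟩, agreeTo_of_encode (hdec.symm ▸ hj)⟩

lemma isSmallestAcc_encode (h' : IsCylOrder le') (h01 : wlt le' w0 w1) {m : W2}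
    (hm : IsSmallestAcc le' (supWords le') m) :
    IsSmallestAcc (treeLe (ascending f le')) (MAbs (treeLe (ascending f le')))
      (encode f m) := by
  obtain ⟨hacc, hmin⟩ := hm
  simp only [isAccPt'_iff] at hacc hmin
  simp only [IsSmallestAcc, isAccPt'_iff]
  constructor
  · intro n
    obtain ⟨y, hy, hne, hag⟩ := hacc n
    exact ⟨_, encode_mem_MAbs h' hy, (encode_injective f).ne hne, agreeTo_encode f hag⟩
  · intro y hy
    by_cases h0 : y 0 = T3.pos
    · by_cases hadm : LocallyAdmissible f y
      · have hcl : ∀ n, ∃ t ∈ supWords le', encode f t ≠ y ∧ AgreeTo n y (encode f t) := by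
          intro n
          obtain ⟨z, hz, hne, hag⟩ := hy (n + 3)
          obtain ⟨t, ht, rfl⟩ := exists_eq_encode_of_mem_MAbs h' h01 hz
            ((hag 0 (by omega)).symm.trans h0) (hadm.congr (hag.mono (by omega)))
          exact ⟨t, ht, hne, hag.mono (by omega)⟩
        have hdec : encode f (decode f y) = y :=
          encode_decode h0 (admissible_of_closure fun n => (hcl n).imp fun _ h => h.2.2)
        rw [← hdec, treeLe_encode_iff h']
        refine hmin _ fun n => ?_
        obtain ⟨t, ht, hne, hag⟩ := hcl (2 * n)
        exact ⟨t, ht, fun htd => hne (htd ▸ hdec), agreeTo_of_encode (hdec.symm ▸ hag)⟩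
      · exact Or.inr (treeLt_of_locallyAdmissible h' h01 (encode_zero f m) h0
          (locallyAdmissible_encode m) hadm)
    · have hzero : ∀ n, zeroW3 ≠ y ∧ AgreeTo n y zeroW3 := by
        intro n
        obtain ⟨z, hz, hne, hag⟩ := hy (n + 1)
        obtain rfl := eq_zeroW3_of_mem_MAbs hz fun h => h0 ((hag 0 n.succ_pos).trans h)
        exact ⟨hne, hag.mono n.le_succ⟩
      exact absurd (eq_of_forall_agreeTo fun n => (hzero n).2).symm (hzero 0).1

end SupWords

/-- For every cylinder order `⪯` on `{0,1}^∞` with `0^∞ ≺ 1^∞` and every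
`σ ∈ {ρ_0, ρ_1, ρ_2, τ_{0,1}}`, there is a consistent cylinder order `≤` on `{0,±1}^∞`
with `0^∞ < 1^∞` such that `m^abs_≤ = σ(m_⪯)`. -/
theorem stmt_16 (le' : W2 → W2 → Prop) (h' : IsCylOrder le') (h01 : wlt le' w0 w1)
    (σ : W2 → W3) (hσ : σ ∈ sigmaSet) :
    ∃ le : W3 → W3 → Prop, IsCylOrder le ∧ Consistent le ∧ wlt le zeroW3 oneW3 ∧
      ∀ m', IsSmallestAcc le' (supWords le') m' →
        IsSmallestAcc le (MAbs le) (σ m') := by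
  obtain ⟨f, rfl⟩ := exists_eq_encode hσ
  refine ⟨treeLe (ascending f le'), isCylOrder_treeLe ascending_congr,
    consistent_treeLe ascending_congr, ⟨Or.inr (treeLt_of_ne_pos (by simp [zeroW3]) rfl), ?_⟩,
    fun m' hm' => isSmallestAcc_encode h' h01 hm'⟩
  exact fun h => absurd (congrFun h 0) (by simp [zeroW3, oneW3])
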